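/- For every positive odd integer k, the data Ẽ_{−k}, F̃_{−k}, ε_{−k} define a crystal structure on the set M_θ of θ-restricted multisegments, namely: (i) F̃_{−k}(M_θ) ⊆ M_θ and Ẽ_{−k}(M_θ) ⊆ M_θ ⊔ {0}; (ii) F̃_{−k}(Ẽ_{−k}(m)) = m whenever Ẽ_{−k}(m) ≠ 0, and Ẽ_{−k}(F̃_{−k}(m)) = m for all m ∈ M_θ; (iii) ε_{−k}(m) = max{n ≥ 0 : Ẽ_{−k}^n(m) ≠ 0} for every m ∈ M_θ. -/

import Mathlib

/-! Combinatorics of θ-restricted multisegments and their crystal operators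
(Enomoto–Kashiwara, §4.1). -/

noncomputable section
open scoped Classical

/-- Multisegments as elements of the free abelian group on the segments `⟨i,j⟩`. -/
abbrev MS : Type := (ℤ × ℤ) →₀ ℤ

/-- The segment `⟨i,j⟩` viewed as a multisegment. -/
def sg (i j : ℤ) : MS := Finsupp.single (i, j) 1

/-- `m` is a θ-restricted multisegment (`m_{i,j} = 0` unless `−j ≤ i ≤ j`, indices odd,
multiplicities nonnegative). -/
def IsTheta (m : MS) : Prop :=
  ∀ i j : ℤ, m (i, j) ≠ 0 → Odd i ∧ Odd j ∧ -j ≤ i ∧ i ≤ j ∧ 0 < m (i, j)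

/-- `A_j^{(−k)}(m)` for a positive odd integer `k`. -/
def Aneg (k : ℤ) (m : MS) (j : ℤ) : ℤ :=
  if k < j then ∑ᶠ l : ℤ, if Odd l ∧ j ≤ l then m (-k, l) - m (-k + 2, l + 2) else 0
  else if j = k then
    (∑ᶠ l : ℤ, if Odd l ∧ k < l then m (-k, l) - m (-k + 2, l) else 0)
      + 2 * m (-k, k) + (if Odd (m (-k + 2, k)) then 1 else 0)
  else
    (∑ᶠ l : ℤ, if Odd l ∧ k < l then m (-k, l) - m (-k + 2, l) else 0)
      + 2 * m (-k, k) - 2 * m (-k + 2, k - 2)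
      + (∑ᶠ i : ℤ, if Odd i ∧ -k + 2 < i ∧ i ≤ j + 2 then m (i, k) else 0)
      - (∑ᶠ i : ℤ, if Odd i ∧ -k + 2 < i ∧ i ≤ j then m (i, k - 2) else 0)

/-- `ε_{−k}(m) = max{A_j^{(−k)}(m) : j ≥ −k+2}`. -/
def epsNeg (k : ℤ) (m : MS) : ℤ :=
  sSup ((fun j => Aneg k m j) '' {j : ℤ | Odd j ∧ -k + 2 ≤ j})

/-- The rank function realizing the ordering `⋯ > k+2 > k > −k+2 > −k+4 > ⋯ > k−2`
on indices: `j` is larger in this ordering iff `rho k j` is larger in `ℤ`. -/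
def rho (k j : ℤ) : ℤ := if k ≤ j then j else -j

/-- The index `n_f`: the smallest index (in the ordering above) attaining `ε_{−k}(m)`. -/
def nfIdx (k : ℤ) (m : MS) : ℤ :=
  let r := sInf (rho k '' {j : ℤ | Odd j ∧ -k + 2 ≤ j ∧ Aneg k m j = epsNeg k m})
  if k ≤ r then r else -r

/-- The index `n_e`: the largest index (in the ordering above) attaining `ε_{−k}(m)`. -/
def neIdx (k : ℤ) (m : MS) : ℤ :=
  let r := sSup (rho k '' {j : ℤ | Odd j ∧ -k + 2 ≤ j ∧ Aneg k m j = epsNeg k m})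
  if k ≤ r then r else -r

/-- The crystal operator `F̃_{−k}` of Definition 4.1. -/
def FtilNeg (k : ℤ) (m : MS) : MS :=
  if k < nfIdx k m then m - sg (-k + 2) (nfIdx k m) + sg (-k) (nfIdx k m)
  else if nfIdx k m = k then
    (if Odd (m (-k + 2, k)) then m - sg (-k + 2) k + sg (-k) k
     else m - (if k ≠ 1 then sg (-k + 2) (k - 2) else 0) + sg (-k + 2) k)
  else m - (if nfIdx k m ≠ k - 2 then sg (nfIdx k m + 2) (k - 2) else 0) + sg (nfIdx k m + 2) k

/-- The crystal operator `Ẽ_{−k}` of Definition 4.1 (`none` stands for `0`). -/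
def EtilNeg (k : ℤ) (m : MS) : Option MS :=
  if epsNeg k m = 0 then none
  else some (if k < neIdx k m then m - sg (-k) (neIdx k m) + sg (-k + 2) (neIdx k m)
    else if neIdx k m = k then
      (if Odd (m (-k + 2, k)) then
        m - sg (-k + 2) k + (if k ≠ 1 then sg (-k + 2) (k - 2) else 0)
       else m - sg (-k) k + sg (-k + 2) k)
    else m - sg (neIdx k m + 2) k + (if neIdx k m ≠ k - 2 then sg (neIdx k m + 2) (k - 2) else 0))

/-- `n`-th iterate of `Ẽ_{−k}` (with `0 ↦ 0`). -/
def EtilNegIter (k : ℤ) (n : ℕ) (m : MS) : Option MS :=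
  (fun o => Option.bind o (EtilNeg k))^[n] (some m)

/-- `A_j^{(k)}(m)` for a positive odd integer `k` and `j ≥ k` (Definition 3.7). -/
def Apos (k : ℤ) (m : MS) (j : ℤ) : ℤ :=
  ∑ᶠ l : ℤ, if Odd l ∧ j ≤ l then m (k, l) - m (k + 2, l + 2) else 0

/-- `ε_k(m) = max{A_j^{(k)}(m) : j ≥ k}` for `k > 0`. -/
def epsPos (k : ℤ) (m : MS) : ℤ :=
  sSup ((fun j => Apos k m j) '' {j : ℤ | Odd j ∧ k ≤ j})

/-- The smallest `j ≥ k` attaining `ε_k(m)`. -/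
def jfIdx (k : ℤ) (m : MS) : ℤ := sInf {j : ℤ | Odd j ∧ k ≤ j ∧ Apos k m j = epsPos k m}

/-- The largest `j ≥ k` attaining `ε_k(m)`. -/
def jeIdx (k : ℤ) (m : MS) : ℤ := sSup {j : ℤ | Odd j ∧ k ≤ j ∧ Apos k m j = epsPos k m}

/-- The crystal operator `F̃_k` for `k > 0`. -/
def FtilPos (k : ℤ) (m : MS) : MS :=
  m - (if jfIdx k m ≠ k then sg (k + 2) (jfIdx k m) else 0) + sg k (jfIdx k m)

/-- The crystal operator `Ẽ_k` for `k > 0` (`none` stands for `0`). -/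
def EtilPos (k : ℤ) (m : MS) : Option MS :=
  if epsPos k m = 0 then none
  else some (m - sg k (jeIdx k m) + (if jeIdx k m ≠ k then sg (k + 2) (jeIdx k m) else 0))

/-- `ε_k(m)` for any odd `k`. -/
def eps (k : ℤ) (m : MS) : ℤ := if 0 < k then epsPos k m else epsNeg (-k) m

/-- The crystal operator `F̃_k` for any odd `k`. -/
def Ftil (k : ℤ) (m : MS) : MS := if 0 < k then FtilPos k m else FtilNeg (-k) m

/-- The crystal operator `Ẽ_k` for any odd `k`. -/
def Etil (k : ℤ) (m : MS) : Option MS := if 0 < k then EtilPos k m else EtilNeg (-k) m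

/-- `n`-th iterate of `Ẽ_k` (with `0 ↦ 0`). -/
def EtilIter (k : ℤ) (n : ℕ) (m : MS) : Option MS :=
  (fun o => Option.bind o (Etil k))^[n] (some m)

lemma sg_apply (a b i j : ℤ) : sg a b (i, j) = if i = a ∧ j = b then 1 else 0 := by
  simp only [sg, Finsupp.single_apply, Prod.mk.injEq]
  split_ifs <;> first | rfl | (exfalso; omega)

/-- `A^{(−k)}` along the chain of indices, listed by increasing rank. -/
def rankA (k : ℤ) (m : MS) (r : ℤ) : ℤ := Aneg k m (if k ≤ r then r else -r)

/-- The change in `rankA` between the consecutive ranks `r` and `r + 2`. -/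
def rankStep (k : ℤ) (m : MS) (r : ℤ) : ℤ :=
  if k < r then m (-k, r) - m (-k + 2, r + 2)
  else if r = k then
    2 * m (-k, k) + (if Odd (m (-k + 2, k)) then 1 else 0) - m (-k + 2, k + 2)
  else if r = k - 2 then
    m (-k + 4, k) - 2 * m (-k + 2, k - 2) - (if Odd (m (-k + 2, k)) then 1 else 0)
  else m (-r + 2, k) - m (-r, k - 2)

/-- The operator `F̃_{−k}` acting at the index of rank `p`. -/
def lowerAt (k : ℤ) (m : MS) (p : ℤ) : MS :=
  if k < p then m - sg (-k + 2) p + sg (-k) p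
  else if p = k then
    (if Odd (m (-k + 2, k)) then m - sg (-k + 2) k + sg (-k) k
     else m - (if k ≠ 1 then sg (-k + 2) (k - 2) else 0) + sg (-k + 2) k)
  else m - (if -p ≠ k - 2 then sg (-p + 2) (k - 2) else 0) + sg (-p + 2) k

/-- The operator `Ẽ_{−k}` acting at the index of rank `p`. -/
def raiseAt (k : ℤ) (m : MS) (p : ℤ) : MS :=
  if k < p then m - sg (-k) p + sg (-k + 2) p
  else if p = k then
    (if Odd (m (-k + 2, k)) then
      m - sg (-k + 2) k + (if k ≠ 1 then sg (-k + 2) (k - 2) else 0)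
     else m - sg (-k) k + sg (-k + 2) k)
  else m - sg (-p + 2) k + (if -p ≠ k - 2 then sg (-p + 2) (k - 2) else 0)

/-- The increment of `rankA` at rank `r` under `F̃_{−k}` acting at rank `p`. -/
def bump (p r : ℤ) : ℤ := if r < p then 2 else if r = p then 1 else 0

/-- `p` is the lowest rank at which `rankA` is maximal. -/
def IsLowest (k : ℤ) (m : MS) (p : ℤ) : Prop :=
  Odd p ∧ -k + 2 ≤ p ∧ (∀ r, Odd r → -k + 2 ≤ r → rankA k m r ≤ rankA k m p) ∧
    ∀ r, Odd r → -k + 2 ≤ r → r < p → rankA k m r < rankA k m p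

/-- `p` is the highest rank at which `rankA` is maximal. -/
def IsHighest (k : ℤ) (m : MS) (p : ℤ) : Prop :=
  Odd p ∧ -k + 2 ≤ p ∧ (∀ r, Odd r → -k + 2 ≤ r → rankA k m r ≤ rankA k m p) ∧
    ∀ r, Odd r → p < r → rankA k m r < rankA k m p

lemma finite_support_row (m : MS) (a b : ℤ) :
    (Function.support fun l => m (a, l + b)).Finite := by
  refine Set.Finite.subset (m.support.finite_toSet.preimage
    (f := fun l : ℤ => (a, l + b)) ?_) ?_
  · intro x _ y _ h
    simpa using h
  · intro x hx
    simpa using hx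

lemma finite_support_column (m : MS) (b : ℤ) :
    (Function.support fun i => m (i, b)).Finite := by
  refine Set.Finite.subset (m.support.finite_toSet.preimage
    (f := fun l : ℤ => (l, b)) ?_) ?_
  · intro x _ y _ h
    simpa using h
  · intro x hx
    simpa using hx

lemma finite_support_ite {g : ℤ → ℤ} (hg : (Function.support g).Finite) (P : ℤ → Prop)
    [DecidablePred P] :
    (Function.support fun l => if P l then g l else 0).Finite := by
  refine hg.subset fun x hx => ?_
  simp only [Function.mem_support] at hx ⊢
  exact fun h => hx (by simp [h])

lemma finsum_ite_insert {g : ℤ → ℤ} (hg : (Function.support g).Finite) {P Q : ℤ → Prop}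
    [DecidablePred P] [DecidablePred Q] {a : ℤ} (h : ∀ l, P l ↔ Q l ∨ l = a) (ha : ¬ Q a) :
    (∑ᶠ l, if P l then g l else 0) = (∑ᶠ l, if Q l then g l else 0) + g a := by
  have hs : (∑ᶠ l, if l = a then g l else 0) = g a := by
    rw [finsum_eq_single _ a (fun x hx => by simp [hx])]
    simp
  rw [← hs, ← finsum_add_distrib (finite_support_ite hg _) (finite_support_ite hg _)]
  refine finsum_congr fun l => ?_
  by_cases hl : l = a
  · subst hl
    simp [h, ha]
  · simp [h, hl]

lemma finsum_ite_sub {f g : ℤ → ℤ} (hf : (Function.support f).Finite)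
    (hg : (Function.support g).Finite) (P : ℤ → Prop)
    [DecidablePred P] :
    (∑ᶠ l, if P l then f l - g l else 0) =
      (∑ᶠ l, if P l then f l else 0) - ∑ᶠ l, if P l then g l else 0 := by
  rw [← finsum_sub_distrib (finite_support_ite hf _) (finite_support_ite hg _)]
  refine finsum_congr fun l => ?_
  split_ifs <;> simp

lemma rankA_sub_rankA {k r : ℤ} (m : MS) (hk : Odd k) (hr : Odd r) (hkr : -k + 2 ≤ r) :
    rankA k m r - rankA k m (r + 2) = rankStep k m r := by
  have row (a : ℤ) : (Function.support fun l => m (a, l)).Finite := by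
    simpa using finite_support_row m a 0
  rcases lt_trichotomy r k with h | rfl | h
  · by_cases h2 : r = k - 2
    · subst h2
      have e1 : rankStep k m (k - 2) = m (-k + 4, k) - 2 * m (-k + 2, k - 2)
          - (if Odd (m (-k + 2, k)) then 1 else 0) := by
        simp [rankStep]
      have e2 : (∑ᶠ i : ℤ, if Odd i ∧ -k + 2 < i ∧ i ≤ -(k - 2) + 2 then m (i, k) else 0)
          = m (-k + 4, k) := by
        rw [finsum_eq_single _ (-k + 4)]
        · rw [if_pos]
          refine ⟨?_, by omega, by omega⟩
          rw [Int.odd_iff] at *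
          omega
        · intro x hx
          rw [if_neg]
          rw [Int.odd_iff] at *
          omega
      have e3 : (∑ᶠ i : ℤ, if Odd i ∧ -k + 2 < i ∧ i ≤ -(k - 2) then m (i, k - 2) else 0)
          = 0 := by
        rw [finsum_congr (g := fun _ => (0 : ℤ)), finsum_zero]
        intro x
        rw [if_neg]
        omega
      rw [e1]
      simp only [rankA, Aneg]
      rw [if_neg (by omega : ¬ k ≤ k - 2), if_pos (by omega : k ≤ k - 2 + 2),
        if_neg (by omega : ¬ k < -(k - 2)), if_neg (by omega : ¬ -(k - 2) = k),
        if_neg (by omega : ¬ k < k - 2 + 2), if_pos (by omega : k - 2 + 2 = k), e2, e3]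
      ring
    · have hrk : r + 2 < k := by
        rw [Int.odd_iff] at *
        omega
      have e1 : rankStep k m r = m (-r + 2, k) - m (-r, k - 2) := by
        rw [rankStep, if_neg (by omega), if_neg (by omega), if_neg h2]
      have e2 := finsum_ite_insert (finite_support_column m k)
        (P := fun i => Odd i ∧ -k + 2 < i ∧ i ≤ -r + 2)
        (Q := fun i => Odd i ∧ -k + 2 < i ∧ i ≤ -(r + 2) + 2) (a := -r + 2)
        (by intro l; simp only [Int.odd_iff] at *; omega) (by omega)
      have e3 := finsum_ite_insert (finite_support_column m (k - 2))
        (P := fun i => Odd i ∧ -k + 2 < i ∧ i ≤ -r)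
        (Q := fun i => Odd i ∧ -k + 2 < i ∧ i ≤ -(r + 2)) (a := -r)
        (by intro l; simp only [Int.odd_iff] at *; omega) (by omega)
      rw [e1]
      simp only [rankA, Aneg]
      rw [if_neg (by omega : ¬ k ≤ r), if_neg (by omega : ¬ k ≤ r + 2),
        if_neg (by omega : ¬ k < -r), if_neg (by omega : ¬ -r = k),
        if_neg (by omega : ¬ k < -(r + 2)), if_neg (by omega : ¬ -(r + 2) = k), e2, e3]
      ring
  · have e1 : rankStep r m r = 2 * m (-r, r) + (if Odd (m (-r + 2, r)) then 1 else 0)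
        - m (-r + 2, r + 2) := by
      simp [rankStep]
    have hshift : (∑ᶠ l : ℤ, if Odd l ∧ r + 2 ≤ l then m (-r + 2, l + 2) else 0) =
        ∑ᶠ l : ℤ, if Odd l ∧ r + 4 ≤ l then m (-r + 2, l) else 0 := by
      rw [← finsum_comp_equiv (Equiv.addRight (2 : ℤ))
        (f := fun l => if Odd l ∧ r + 4 ≤ l then m (-r + 2, l) else 0)]
      refine finsum_congr fun l => ?_
      simp only [Equiv.coe_addRight]
      refine if_congr ?_ rfl rfl
      simp only [Int.odd_iff]
      omega
    have e2 := finsum_ite_insert (row (-r + 2))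
        (P := fun l => Odd l ∧ r < l)
        (Q := fun l => Odd l ∧ r + 4 ≤ l) (a := r + 2)
        (by intro l; simp only [Int.odd_iff] at *; omega) (by omega)
    have e3 : (∑ᶠ l : ℤ, if Odd l ∧ r + 2 ≤ l then m (-r, l) else 0) =
        ∑ᶠ l : ℤ, if Odd l ∧ r < l then m (-r, l) else 0 := by
      refine finsum_congr fun l => if_congr ?_ rfl rfl
      simp only [Int.odd_iff] at *
      omega
    rw [e1]
    simp only [rankA, Aneg]
    rw [if_pos le_rfl, if_pos (by omega : r ≤ r + 2), if_neg (by omega : ¬ r < r), if_pos rfl,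
      if_pos (by omega : r < r + 2), finsum_ite_sub (row _) (row _),
      finsum_ite_sub (row _) (finite_support_row _ _ _), hshift, e2, e3]
    ring
  · have e1 : rankStep k m r = m (-k, r) - m (-k + 2, r + 2) := if_pos h
    have hfin : (Function.support fun l => m (-k, l) - m (-k + 2, l + 2)).Finite :=
      ((row (-k)).union (finite_support_row m (-k + 2) 2)).subset (Function.support_sub _ _)
    have e2 := finsum_ite_insert hfin (P := fun l => Odd l ∧ r ≤ l)
        (Q := fun l => Odd l ∧ r + 2 ≤ l) (a := r)
        (by intro l; simp only [Int.odd_iff] at *; omega) (by omega)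
    rw [e1]
    simp only [rankA, Aneg]
    rw [if_pos h.le, if_pos (by omega : k ≤ r + 2), if_pos h,
      if_pos (by omega : k < r + 2), e2]
    ring

lemma exists_rankA_eq_zero (k : ℤ) (m : MS) : ∃ N : ℤ, ∀ r, N ≤ r → rankA k m r = 0 := by
  obtain ⟨N, hN⟩ := (m.support.image Prod.snd).bddAbove
  have hz (a b : ℤ) (hb : N < b) : m (a, b) = 0 := by
    by_contra h
    exact hb.not_ge (hN (Finset.mem_coe.2
      (Finset.mem_image.2 ⟨(a, b), Finsupp.mem_support_iff.2 h, rfl⟩)))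
  refine ⟨max (N + 1) (k + 1), fun r hr => ?_⟩
  have hr1 := (le_max_left _ _).trans hr
  have hr2 := (le_max_right _ _).trans hr
  rw [rankA, if_pos (by omega), Aneg, if_pos (by omega),
    finsum_congr (g := fun _ => (0 : ℤ)), finsum_zero]
  intro l
  split_ifs with h
  · rw [hz _ _ (by omega), hz _ _ (by omega), sub_zero]
  · rfl

/-- A function on ranks is determined by its steps and its vanishing at infinity. -/
lemma eq_zero_of_step {f : ℤ → ℤ} {a N : ℤ} (hN : ∀ r, N ≤ r → f r = 0)
    (hf : ∀ r, Odd r → a ≤ r → f r = f (r + 2)) {r : ℤ} (hr : Odd r) (har : a ≤ r) :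
    f r = 0 := by
  have key : ∀ n : ℕ, f r = f (r + 2 * n) := by
    intro n
    induction n with
    | zero => simp
    | succ n ih =>
      rw [ih, hf (r + 2 * n) (hr.add_even (even_two_mul _)) (by omega)]
      congr 1
      push_cast
      ring
  rw [key (N - r).toNat]
  exact hN _ (by omega)

lemma rankA_eq_add_bump {k p r : ℤ} {m m' : MS} (hk : Odd k)
    (h : ∀ r, Odd r → -k + 2 ≤ r →
      rankStep k m' r = rankStep k m r + bump p r - bump p (r + 2))
    (hr : Odd r) (hkr : -k + 2 ≤ r) : rankA k m' r = rankA k m r + bump p r := by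
  obtain ⟨N, hN⟩ := exists_rankA_eq_zero k m
  obtain ⟨N', hN'⟩ := exists_rankA_eq_zero k m'
  have := eq_zero_of_step (f := fun r => rankA k m' r - rankA k m r - bump p r)
    (a := -k + 2) (N := max (max N N') (p + 1)) ?_ ?_ hr hkr
  · linarith
  · intro r hr
    have h1 : N ≤ r := by omega
    have h2 : N' ≤ r := by omega
    simp only [hN r h1, hN' r h2, bump]
    rw [if_neg (by omega), if_neg (by omega)]
    rfl
  · intro r hr hkr
    have h1 := rankA_sub_rankA m hk hr hkr
    have h2 := rankA_sub_rankA m' hk hr hkr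
    have h3 := h r hr hkr
    linarith

lemma sg_apply_nested (a b i j : ℤ) :
    sg a b (i, j) = if i = a then if j = b then 1 else 0 else 0 := by
  rw [sg_apply, ite_and]

lemma rankStep_lowerAt_of_gt {k p r : ℤ} (m : MS) (hk : Odd k) (hp : Odd p) (hkp : k < p)
    (hr : Odd r) :
    rankStep k (lowerAt k m p) r = rankStep k m r + bump p r - bump p (r + 2) := by
  simp only [Int.odd_iff] at hk hp hr
  have hr_cases : k < r ∨ r = k ∨ r = k - 2 ∨ r < k - 2 := by omega
  rw [lowerAt, if_pos hkp]
  rcases hr_cases with h | h | h | h <;>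
    simp (disch := omega) only [rankStep, bump, if_pos, if_neg, Int.odd_iff,
      Finsupp.add_apply, Finsupp.sub_apply, sg_apply_nested, sub_zero, add_zero] <;>
    (try split_ifs) <;> omega

lemma rankStep_lowerAt_self {k r : ℤ} (m : MS) (hk : Odd k) (hr : Odd r) (hkr : -k + 2 ≤ r) :
    rankStep k (lowerAt k m k) r = rankStep k m r + bump k r - bump k (r + 2) := by
  simp only [Int.odd_iff] at hk hr
  have hr_cases : k < r ∨ r = k ∨ r = k - 2 ∨ r < k - 2 := by omega
  rw [lowerAt, if_neg (lt_irrefl k), if_pos rfl]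
  simp only [Int.odd_iff]
  rcases hr_cases with h | h | h | h <;> split_ifs <;>
    simp (disch := omega) only [rankStep, bump, if_pos, if_neg, Int.odd_iff,
      Finsupp.add_apply, Finsupp.sub_apply, sg_apply_nested, sub_zero, add_zero] <;>
    (try split_ifs) <;> omega

lemma rankStep_lowerAt_of_lt {k p r : ℤ} (m : MS) (hk : Odd k) (hp : Odd p)
    (hpk : p < k) (hr : Odd r) (hkr : -k + 2 ≤ r) :
    rankStep k (lowerAt k m p) r = rankStep k m r + bump p r - bump p (r + 2) := by
  simp only [Int.odd_iff] at hk hp hr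
  have hr_cases : k < r ∨ r = k ∨ r = k - 2 ∨ r < k - 2 := by omega
  rw [lowerAt, if_neg (by omega), if_neg (by omega)]
  rcases hr_cases with h | h | h | h <;> split_ifs with h' <;>
    simp (disch := omega) only [rankStep, bump, if_pos, if_neg, Int.odd_iff,
      Finsupp.add_apply, Finsupp.sub_apply, sg_apply_nested, sub_zero, add_zero] <;>
    (try split_ifs) <;> omega

lemma rankStep_lowerAt {k p r : ℤ} (m : MS) (hk : Odd k) (hp : Odd p)
    (hr : Odd r) (hkr : -k + 2 ≤ r) :
    rankStep k (lowerAt k m p) r = rankStep k m r + bump p r - bump p (r + 2) := by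
  rcases lt_trichotomy p k with h | rfl | h
  · exact rankStep_lowerAt_of_lt m hk hp h hr hkr
  · exact rankStep_lowerAt_self m hk hr hkr
  · exact rankStep_lowerAt_of_gt m hk hp h hr

lemma lowerAt_raiseAt (k : ℤ) (m : MS) (p : ℤ) : lowerAt k (raiseAt k m p) p = m := by
  unfold lowerAt raiseAt
  by_cases h1 : k < p
  · simp only [if_pos h1]
    abel
  by_cases h2 : p = k
  · simp only [if_neg h1, if_pos h2]
    have h3 : ¬ (-k + 2 = -k) := by omega
    have h4 : ¬ (k = k - 2) := by omega
    by_cases h5 : k = 1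
    · subst h5
      by_cases h6 : Odd (m (1, 1)) <;> simp [h6, sg_apply]
    · by_cases h6 : Odd (m (-k + 2, k)) <;>
        simp [h6, h5, h3, h4, sg_apply]
  · simp only [if_neg h1, if_neg h2]
    abel

lemma raiseAt_lowerAt (k : ℤ) (m : MS) (p : ℤ) : raiseAt k (lowerAt k m p) p = m := by
  unfold lowerAt raiseAt
  by_cases h1 : k < p
  · simp only [if_pos h1]
    abel
  by_cases h2 : p = k
  · simp only [if_neg h1, if_pos h2]
    have h3 : ¬ (-k + 2 = -k) := by omega
    have h4 : ¬ (k = k - 2) := by omega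
    by_cases h5 : k = 1
    · subst h5
      by_cases h6 : Odd (m (1, 1)) <;> simp [h6, sg_apply]
    · by_cases h6 : Odd (m (-k + 2, k)) <;>
        simp [h6, h5, h3, h4, sg_apply]
  · simp only [if_neg h1, if_neg h2]
    abel

lemma rankA_lowerAt {k p r : ℤ} (m : MS) (hk : Odd k) (hp : Odd p)
    (hr : Odd r) (hkr : -k + 2 ≤ r) :
    rankA k (lowerAt k m p) r = rankA k m r + bump p r :=
  rankA_eq_add_bump hk (fun _ hr hkr => rankStep_lowerAt m hk hp hr hkr) hr hkr

lemma rankA_raiseAt {k p r : ℤ} (m : MS) (hk : Odd k) (hp : Odd p)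
    (hr : Odd r) (hkr : -k + 2 ≤ r) :
    rankA k (raiseAt k m p) r = rankA k m r - bump p r := by
  have := rankA_lowerAt (raiseAt k m p) hk hp hr hkr
  rw [lowerAt_raiseAt] at this
  linarith

lemma IsLowest.isHighest_lowerAt {k p : ℤ} {m : MS} (hk : Odd k)
    (h : IsLowest k m p) : IsHighest k (lowerAt k m p) p := by
  obtain ⟨hp, hkp, hmax, hlt⟩ := h
  refine ⟨hp, hkp, fun r hr hkr => ?_, fun r hr hpr => ?_⟩ <;>
    rw [rankA_lowerAt m hk hp hr (by omega), rankA_lowerAt m hk hp hp hkp] <;>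
    have h1 := hmax r hr (by omega) <;>
    have h2 := hlt r hr (by omega) <;>
    unfold bump <;> split_ifs <;> omega

lemma IsHighest.isLowest_raiseAt {k p : ℤ} {m : MS} (hk : Odd k)
    (h : IsHighest k m p) : IsLowest k (raiseAt k m p) p := by
  obtain ⟨hp, hkp, hmax, hlt⟩ := h
  refine ⟨hp, hkp, fun r hr hkr => ?_, fun r hr hkr hpr => ?_⟩ <;>
    rw [rankA_raiseAt m hk hp hr hkr, rankA_raiseAt m hk hp hp hkp] <;>
    have h1 := hmax r hr hkr <;>
    have h2 := hlt r hr <;>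
    unfold bump <;> split_ifs <;> omega

lemma sub_add_isTheta {m : MS} {a b c d : ℤ} (hm : IsTheta m) (hab : 0 < m (a, b))
    (hc : Odd c) (hd : Odd d) (hcd : -d ≤ c) (hcd' : c ≤ d) :
    IsTheta (m - sg a b + sg c d) := by
  intro i j hij
  have hij' := hm i j
  simp only [Finsupp.add_apply, Finsupp.sub_apply, sg_apply] at hij ⊢
  by_cases h1 : i = a ∧ j = b
  · obtain ⟨rfl, rfl⟩ := h1
    have := hij' hab.ne'
    refine ⟨this.1, this.2.1, this.2.2.1, this.2.2.2.1, ?_⟩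
    split_ifs at * <;> omega
  · by_cases h2 : i = c ∧ j = d
    · obtain ⟨rfl, rfl⟩ := h2
      refine ⟨hc, hd, hcd, hcd', ?_⟩
      by_cases h0 : m (i, j) = 0
      · simp [h0, h1]
      · have := hij' h0
        rw [if_neg h1]
        simp
        omega
    · simpa [h1, h2] using hij' (by simpa [h1, h2] using hij)

lemma add_isTheta {m : MS} {c d : ℤ} (hm : IsTheta m)
    (hc : Odd c) (hd : Odd d) (hcd : -d ≤ c) (hcd' : c ≤ d) : IsTheta (m + sg c d) := by
  intro i j hij
  have hij' := hm i j
  simp only [Finsupp.add_apply, sg_apply] at hij ⊢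
  by_cases h2 : i = c ∧ j = d
  · obtain ⟨rfl, rfl⟩ := h2
    refine ⟨hc, hd, hcd, hcd', ?_⟩
    by_cases h0 : m (i, j) = 0
    · simp [h0]
    · have := hij' h0
      simp
      omega
  · simpa [h2] using hij' (by simpa [h2] using hij)

lemma sub_isTheta {m : MS} {a b : ℤ} (hm : IsTheta m) (hab : 0 < m (a, b)) :
    IsTheta (m - sg a b) := by
  intro i j hij
  have hij' := hm i j
  simp only [Finsupp.sub_apply, sg_apply] at hij ⊢
  by_cases h1 : i = a ∧ j = b
  · obtain ⟨rfl, rfl⟩ := h1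
    have := hij' hab.ne'
    refine ⟨this.1, this.2.1, this.2.2.1, this.2.2.2.1, ?_⟩
    split_ifs at * <;> omega
  · simpa [h1] using hij' (by simpa [h1] using hij)

lemma IsTheta.nonneg {m : MS} (hm : IsTheta m) (i j : ℤ) : 0 ≤ m (i, j) := by
  by_cases h : m (i, j) = 0
  · exact h.ge
  · exact (hm i j h).2.2.2.2.le

lemma IsLowest.isTheta_lowerAt {k p : ℤ} {m : MS} (hm : IsTheta m) (hk : Odd k) (hk0 : 0 < k)
    (h : IsLowest k m p) : IsTheta (lowerAt k m p) := by
  obtain ⟨hp, hkp, -, hlt⟩ := h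
  have hstep (h2 : -k + 2 ≤ p - 2) : rankStep k m (p - 2) < 0 := by
    have hp2 : Odd (p - 2) := hp.sub_even even_two
    have h3 := rankA_sub_rankA m hk hp2 h2
    have h4 := hlt (p - 2) hp2 h2 (by omega)
    rw [sub_add_cancel] at h3
    omega
  have hpar : p % 2 = 1 := Int.odd_iff.1 hp
  have hkar : k % 2 = 1 := Int.odd_iff.1 hk
  have hk2 : Odd (-k + 2) := hk.neg.add_even even_two
  have hp2 : Odd (-p + 2) := hp.neg.add_even even_two
  unfold rankStep at hstep
  unfold lowerAt
  have e1 := hm.nonneg (-k) (p - 2)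
  have e2 := hm.nonneg (-k) k
  have e3 := hm.nonneg (-k + 2) k
  have e4 := hm.nonneg (-k + 4) k
  have e5 := hm.nonneg (-(p - 2) + 2) k
  by_cases h1 : k < p
  · rw [if_pos h1]
    refine sub_add_isTheta hm ?_ hk.neg hp (by omega) (by omega)
    have := hstep (by omega)
    rw [sub_add_cancel] at this
    by_cases h2 : p - 2 = k
    · obtain rfl : p = k + 2 := by omega
      simp only [add_sub_cancel_right] at *
      split_ifs at this <;> omega
    · rw [if_pos (by omega)] at this
      omega
  by_cases h2 : p = k
  · subst h2
    rw [if_neg h1, if_pos rfl]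
    by_cases h3 : Odd (m (-p + 2, p))
    · rw [if_pos h3]
      refine sub_add_isTheta hm ?_ hk.neg hk (by omega) (by omega)
      rw [Int.odd_iff] at h3
      omega
    rw [if_neg h3]
    by_cases h4 : p = 1
    · rw [if_neg (by simpa using h4), sub_zero]
      exact add_isTheta hm hk2 hk (by omega) (by omega)
    · rw [if_pos h4]
      refine sub_add_isTheta hm ?_ hk2 hk (by omega) (by omega)
      have := hstep (by omega)
      rw [if_neg (by omega), if_neg (by omega), if_pos rfl, if_neg h3] at this
      omega
  · rw [if_neg h1, if_neg h2]
    by_cases h3 : -p = k - 2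
    · rw [if_neg (by simpa using h3), sub_zero]
      exact add_isTheta hm hp2 hk (by omega) (by omega)
    · rw [if_pos h3]
      refine sub_add_isTheta hm ?_ hp2 hk (by omega) (by omega)
      have := hstep (by omega)
      rw [if_neg (by omega), if_neg (by omega), if_neg (by omega),
        show -(p - 2) = -p + 2 by ring] at this
      rw [show -(p - 2) = -p + 2 by ring] at e5
      omega

lemma IsHighest.isTheta_raiseAt {k p : ℤ} {m : MS} (hm : IsTheta m) (hk : Odd k) (hk0 : 0 < k)
    (h : IsHighest k m p) : IsTheta (raiseAt k m p) := by
  obtain ⟨hp, hkp, -, hlt⟩ := h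
  have hstep : 0 < rankStep k m p := by
    have h3 := rankA_sub_rankA m hk hp hkp
    have h4 := hlt (p + 2) (hp.add_even even_two) (by omega)
    omega
  have hpar : p % 2 = 1 := Int.odd_iff.1 hp
  have hkar : k % 2 = 1 := Int.odd_iff.1 hk
  have hk2 : Odd (-k + 2) := hk.neg.add_even even_two
  have hkk : Odd (k - 2) := hk.sub_even even_two
  have hp2 : Odd (-p + 2) := hp.neg.add_even even_two
  unfold rankStep at hstep
  unfold raiseAt
  have e1 := hm.nonneg (-k + 2) (p + 2)
  have e2 := hm.nonneg (-k + 2) (k + 2)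
  have e3 := hm.nonneg (-k + 2) k
  have e4 := hm.nonneg (-k + 2) (k - 2)
  have e5 := hm.nonneg (-p) (k - 2)
  by_cases h1 : k < p
  · rw [if_pos h1] at *
    exact sub_add_isTheta hm (by omega) hk2 hp (by omega) (by omega)
  by_cases h2 : p = k
  · subst h2
    rw [if_neg h1, if_pos rfl] at *
    by_cases h3 : Odd (m (-p + 2, p))
    · have hpos : 0 < m (-p + 2, p) := by
        rw [Int.odd_iff] at h3
        omega
      rw [if_pos h3]
      by_cases h4 : p = 1
      · rw [if_neg (by simpa using h4), add_zero]
        exact sub_isTheta hm hpos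
      · rw [if_pos h4]
        exact sub_add_isTheta hm hpos hk2 hkk (by omega) (by omega)
    · rw [if_neg h3] at *
      exact sub_add_isTheta hm (by omega) hk2 hk (by omega) (by omega)
  · rw [if_neg h1, if_neg h2] at *
    have hpos : 0 < m (-p + 2, k) := by
      by_cases h3 : p = k - 2
      · rw [if_pos h3] at hstep
        rw [show -p + 2 = -k + 4 by omega]
        split_ifs at hstep <;> omega
      · rw [if_neg h3] at hstep
        omega
    by_cases h3 : -p = k - 2
    · rw [if_neg (by simpa using h3), add_zero]
      exact sub_isTheta hm hpos
    · rw [if_pos h3]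
      exact sub_add_isTheta hm hpos hp2 hkk (by omega) (by omega)

lemma rho_mem {k r : ℤ} (hk : Odd k) (hr : Odd r ∧ -k + 2 ≤ r) :
    Odd (rho k r) ∧ -k + 2 ≤ rho k r := by
  obtain ⟨h1, h2⟩ := hr
  rw [Int.odd_iff] at *
  unfold rho
  split_ifs <;> omega

lemma rho_rho {k r : ℤ} (hr : -k + 2 ≤ r) : rho k (rho k r) = r := by
  unfold rho
  split_ifs <;> omega

lemma Aneg_eq_rankA {k r : ℤ} (m : MS) (hr : -k + 2 ≤ r) : Aneg k m r = rankA k m (rho k r) := by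
  conv_lhs => rw [← rho_rho hr]
  rfl

lemma epsNeg_eq_sSup {k : ℤ} (m : MS) (hk : Odd k) :
    epsNeg k m = sSup (rankA k m '' {r : ℤ | Odd r ∧ -k + 2 ≤ r}) := by
  rw [epsNeg]
  congr 1
  ext x
  constructor
  · rintro ⟨j, hj, rfl⟩
    exact ⟨rho k j, rho_mem hk hj, (Aneg_eq_rankA m hj.2).symm⟩
  · rintro ⟨r, hr, rfl⟩
    exact ⟨rho k r, rho_mem hk hr, rfl⟩

lemma rho_image_maximizers {k : ℤ} (m : MS) (hk : Odd k) :
    rho k '' {j : ℤ | Odd j ∧ -k + 2 ≤ j ∧ Aneg k m j = epsNeg k m} =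
      {r : ℤ | Odd r ∧ -k + 2 ≤ r ∧ rankA k m r = epsNeg k m} := by
  ext r
  constructor
  · rintro ⟨j, ⟨h1, h2, h3⟩, rfl⟩
    exact ⟨(rho_mem hk ⟨h1, h2⟩).1, (rho_mem hk ⟨h1, h2⟩).2, by rw [← Aneg_eq_rankA m h2, h3]⟩
  · rintro ⟨h1, h2, h3⟩
    exact ⟨rho k r, ⟨(rho_mem hk ⟨h1, h2⟩).1, (rho_mem hk ⟨h1, h2⟩).2, h3⟩, rho_rho h2⟩

lemma epsNeg_eq_rankA {k p : ℤ} {m : MS} (hk : Odd k) (hp : Odd p) (hkp : -k + 2 ≤ p)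
    (hmax : ∀ r, Odd r → -k + 2 ≤ r → rankA k m r ≤ rankA k m p) :
    epsNeg k m = rankA k m p := by
  rw [epsNeg_eq_sSup m hk]
  refine IsGreatest.csSup_eq ⟨⟨p, ⟨hp, hkp⟩, rfl⟩, ?_⟩
  rintro _ ⟨r, ⟨h1, h2⟩, rfl⟩
  exact hmax r h1 h2

lemma IsLowest.epsNeg_eq {k p : ℤ} {m : MS} (hk : Odd k) (h : IsLowest k m p) :
    epsNeg k m = rankA k m p :=
  epsNeg_eq_rankA hk h.1 h.2.1 h.2.2.1

lemma IsHighest.epsNeg_eq {k p : ℤ} {m : MS} (hk : Odd k) (h : IsHighest k m p) :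
    epsNeg k m = rankA k m p :=
  epsNeg_eq_rankA hk h.1 h.2.1 h.2.2.1

lemma IsLowest.FtilNeg_eq {k p : ℤ} {m : MS} (hk : Odd k) (h : IsLowest k m p) :
    FtilNeg k m = lowerAt k m p := by
  have hn : nfIdx k m = rho k p := by
    change rho k (sInf _) = _
    rw [rho_image_maximizers m hk, h.epsNeg_eq hk]
    congr 1
    obtain ⟨hp, hkp, -, hlt⟩ := h
    refine IsLeast.csInf_eq ⟨⟨hp, hkp, rfl⟩, ?_⟩
    rintro r ⟨h1, h2, h3⟩
    by_contra hr
    exact (hlt r h1 h2 (not_le.1 hr)).ne h3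
  have hkp := h.2.1
  rw [FtilNeg, lowerAt, hn, rho]
  by_cases h1 : k ≤ p
  · rw [if_pos h1]
    split_ifs <;> first | rfl | (exfalso; omega)
  · rw [if_neg h1]
    split_ifs <;> first | rfl | (exfalso; omega)

lemma IsHighest.EtilNeg_eq {k p : ℤ} {m : MS} (hk : Odd k) (h : IsHighest k m p)
    (h0 : epsNeg k m ≠ 0) : EtilNeg k m = some (raiseAt k m p) := by
  have hn : neIdx k m = rho k p := by
    change rho k (sSup _) = _
    rw [rho_image_maximizers m hk, h.epsNeg_eq hk]
    congr 1
    obtain ⟨hp, hkp, -, hlt⟩ := h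
    refine IsGreatest.csSup_eq ⟨⟨hp, hkp, rfl⟩, ?_⟩
    rintro r ⟨h1, h2, h3⟩
    by_contra hr
    exact (hlt r h1 (not_le.1 hr)).ne h3
  have hkp := h.2.1
  rw [EtilNeg, if_neg h0, raiseAt, hn, rho]
  congr 1
  by_cases h1 : k ≤ p
  · rw [if_pos h1]
    split_ifs <;> first | rfl | (exfalso; omega)
  · rw [if_neg h1]
    split_ifs <;> first | rfl | (exfalso; omega)

lemma bddAbove_rankA (k : ℤ) (m : MS) :
    BddAbove (rankA k m '' {r : ℤ | Odd r ∧ -k + 2 ≤ r}) := by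
  obtain ⟨N, hN⟩ := exists_rankA_eq_zero k m
  refine (((Set.finite_Icc (-k + 2) N).image (rankA k m)).union
    (Set.finite_singleton 0)).bddAbove.mono ?_
  rintro _ ⟨r, ⟨-, h2⟩, rfl⟩
  by_cases h : r ≤ N
  · exact Or.inl ⟨r, ⟨h2, h⟩, rfl⟩
  · exact Or.inr (hN r (not_le.1 h).le)

lemma rankA_le_epsNeg {k r : ℤ} (m : MS) (hk : Odd k) (hr : Odd r) (hkr : -k + 2 ≤ r) :
    rankA k m r ≤ epsNeg k m := by
  rw [epsNeg_eq_sSup m hk]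
  exact le_csSup (bddAbove_rankA k m) ⟨r, ⟨hr, hkr⟩, rfl⟩

lemma exists_rankA_eq_epsNeg {k : ℤ} (m : MS) (hk : Odd k) :
    {r : ℤ | Odd r ∧ -k + 2 ≤ r ∧ rankA k m r = epsNeg k m}.Nonempty := by
  have hne : {r : ℤ | Odd r ∧ -k + 2 ≤ r}.Nonempty :=
    ⟨-k + 2, hk.neg.add_even even_two, le_rfl⟩
  obtain ⟨r, hr, h⟩ := Int.csSup_mem (hne.image (rankA k m)) (bddAbove_rankA k m)
  exact ⟨r, hr.1, hr.2, h.trans (epsNeg_eq_sSup m hk).symm⟩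

lemma epsNeg_nonneg {k : ℤ} (m : MS) (hk : Odd k) : 0 ≤ epsNeg k m := by
  obtain ⟨N, hN⟩ := exists_rankA_eq_zero k m
  rw [← hN (2 * max (max N (-k + 2)) 0 + 1) (by omega)]
  exact rankA_le_epsNeg m hk (odd_two_mul_add_one _) (by omega)

lemma exists_isLowest {k : ℤ} (m : MS) (hk : Odd k) : ∃ p, IsLowest k m p := by
  have hbdd : BddBelow {r : ℤ | Odd r ∧ -k + 2 ≤ r ∧ rankA k m r = epsNeg k m} :=
    ⟨-k + 2, fun r hr => hr.2.1⟩
  obtain ⟨h1, h2, h3⟩ := Int.csInf_mem (exists_rankA_eq_epsNeg m hk) hbdd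
  refine ⟨_, h1, h2, fun r hr hkr => (rankA_le_epsNeg m hk hr hkr).trans_eq h3.symm,
    fun r hr hkr hlt => ?_⟩
  refine lt_of_le_of_ne ((rankA_le_epsNeg m hk hr hkr).trans_eq h3.symm) fun he => ?_
  exact hlt.not_ge (csInf_le hbdd ⟨hr, hkr, he.trans h3⟩)

lemma exists_isHighest {k : ℤ} (m : MS) (hk : Odd k) (h0 : epsNeg k m ≠ 0) :
    ∃ p, IsHighest k m p := by
  have hbdd : BddAbove {r : ℤ | Odd r ∧ -k + 2 ≤ r ∧ rankA k m r = epsNeg k m} := by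
    obtain ⟨N, hN⟩ := exists_rankA_eq_zero k m
    refine ⟨N, fun r hr => ?_⟩
    by_contra h
    exact h0 (hr.2.2 ▸ hN r (not_le.1 h).le)
  obtain ⟨h1, h2, h3⟩ := Int.csSup_mem (exists_rankA_eq_epsNeg m hk) hbdd
  refine ⟨_, h1, h2, fun r hr hkr => (rankA_le_epsNeg m hk hr hkr).trans_eq h3.symm,
    fun r hr hlt => ?_⟩
  have hkr := h2.trans hlt.le
  refine lt_of_le_of_ne ((rankA_le_epsNeg m hk hr hkr).trans_eq h3.symm) fun he => ?_
  exact hlt.not_ge (le_csSup hbdd ⟨hr, hkr, he.trans h3⟩)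

lemma exists_isHighest_of_EtilNeg {k : ℤ} {m m' : MS} (hk : Odd k)
    (h : EtilNeg k m = some m') : ∃ p, IsHighest k m p ∧ m' = raiseAt k m p := by
  have h0 : epsNeg k m ≠ 0 := fun h0 => by simp [EtilNeg, h0] at h
  obtain ⟨p, hp⟩ := exists_isHighest m hk h0
  refine ⟨p, hp, ?_⟩
  rw [hp.EtilNeg_eq hk h0] at h
  exact (Option.some.inj h).symm

lemma epsNeg_of_EtilNeg {k : ℤ} {m m' : MS} (hk : Odd k)
    (h : EtilNeg k m = some m') : epsNeg k m' = epsNeg k m - 1 := by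
  obtain ⟨p, hp, rfl⟩ := exists_isHighest_of_EtilNeg hk h
  rw [(hp.isLowest_raiseAt hk).epsNeg_eq hk, hp.epsNeg_eq hk,
    rankA_raiseAt m hk hp.1 hp.1 hp.2.1]
  simp [bump]

lemma EtilNegIter_ne_none_iff {k : ℤ} (hk : Odd k) (n : ℕ) (m : MS) :
    EtilNegIter k n m ≠ none ↔ (n : ℤ) ≤ epsNeg k m := by
  induction n generalizing m with
  | zero => simpa [EtilNegIter] using epsNeg_nonneg m hk
  | succ n ih =>
    have hnn := epsNeg_nonneg m hk
    rw [EtilNegIter, Function.iterate_succ_apply, Option.bind_some]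
    cases h : EtilNeg k m with
    | none =>
      have h0 : epsNeg k m = 0 := by
        by_contra h0
        simp [EtilNeg, h0] at h
      rw [Function.iterate_fixed rfl]
      simp only [ne_eq, not_true_eq_false, false_iff]
      omega
    | some m' =>
      have h1 := epsNeg_of_EtilNeg hk h
      have h2 := ih m'
      rw [EtilNegIter] at h2
      rw [h2, h1]
      push_cast
      omega

/-- Lemma 4.4 of Enomoto–Kashiwara: for a positive odd integer `k`, the data
`Ẽ_{−k}`, `F̃_{−k}`, `ε_{−k}` define a crystal structure on the set `M_θ` of
θ-restricted multisegments. -/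
theorem crystal_structure_neg (k : ℤ) (hk : Odd k) (hkpos : 0 < k) :
    (∀ m : MS, IsTheta m → IsTheta (FtilNeg k m)) ∧
    (∀ m m' : MS, IsTheta m → EtilNeg k m = some m' → IsTheta m') ∧
    (∀ m m' : MS, IsTheta m → EtilNeg k m = some m' → FtilNeg k m' = m) ∧
    (∀ m : MS, IsTheta m → EtilNeg k (FtilNeg k m) = some m) ∧
    (∀ m : MS, IsTheta m → 0 ≤ epsNeg k m ∧
      IsGreatest {n : ℕ | EtilNegIter k n m ≠ none} (epsNeg k m).toNat) := by
  refine ⟨fun m hm => ?_, fun m m' hm h => ?_, fun m m' hm h => ?_, fun m hm => ?_,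
    fun m hm => ⟨epsNeg_nonneg m hk, ?_⟩⟩
  · obtain ⟨p, hp⟩ := exists_isLowest m hk
    rw [hp.FtilNeg_eq hk]
    exact hp.isTheta_lowerAt hm hk hkpos
  · obtain ⟨p, hp, rfl⟩ := exists_isHighest_of_EtilNeg hk h
    exact hp.isTheta_raiseAt hm hk hkpos
  · obtain ⟨p, hp, rfl⟩ := exists_isHighest_of_EtilNeg hk h
    rw [(hp.isLowest_raiseAt hk).FtilNeg_eq hk, lowerAt_raiseAt]
  · obtain ⟨p, hp⟩ := exists_isLowest m hk
    have hh := hp.isHighest_lowerAt hk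
    have h0 : epsNeg k (lowerAt k m p) = epsNeg k m + 1 := by
      rw [hh.epsNeg_eq hk, hp.epsNeg_eq hk, rankA_lowerAt m hk hp.1 hp.1 hp.2.1]
      simp [bump]
    have h1 := epsNeg_nonneg m hk
    rw [hp.FtilNeg_eq hk, hh.EtilNeg_eq hk (by omega), raiseAt_lowerAt]
  · have h0 := epsNeg_nonneg m hk
    refine ⟨(EtilNegIter_ne_none_iff hk _ m).2 (by omega), fun n hn => ?_⟩
    have := (EtilNegIter_ne_none_iff hk n m).1 hn
    omega

end
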